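/- Let (G, t₁, t₂) be a Shannon position and let U be a set of vertices of G with t₁ ∉ U and t₂ ∉ U, such that the neighbourhood Γ(U) is a clique in G. Then every vertex of U is dead, and every edge of G having at least one endpoint in U is dead. -/

import Mathlib

open SimpleGraph

variable {V : Type*}

/-- Short wins the complete colouring `c` in graph `H` (with terminals `t₁, t₂`)
iff there is a walk from `t₁` to `t₂` all of whose internal vertices are black (`true`). -/
def ShortWins (H : SimpleGraph V) (t₁ t₂ : V) (c : V → Bool) : Prop :=
  ∃ p : H.Walk t₁ t₂, ∀ x ∈ p.support, x ≠ t₁ → x ≠ t₂ → c x = true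

/-- A vertex `v` is dead if, for every complete colouring, changing the colour of `v`
does not change whether Short wins. -/
def DeadVertex [DecidableEq V] (G : SimpleGraph V) (t₁ t₂ : V) (v : V) : Prop :=
  ∀ c : V → Bool, (ShortWins G t₁ t₂ c ↔ ShortWins G t₁ t₂ (Function.update c v (! c v)))

/-- An edge `e` is dead if, for every complete colouring, Short wins in `G`
iff Short wins in `G − e`. -/
def DeadEdge (G : SimpleGraph V) (t₁ t₂ : V) (e : Sym2 V) : Prop :=
  ∀ c : V → Bool, (ShortWins G t₁ t₂ c ↔ ShortWins (G.deleteEdges {e}) t₁ t₂ c)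

/-- The neighbourhood `Γ(S)` of a vertex set: vertices outside `S` adjacent to a member of `S`. -/
def nbhd (G : SimpleGraph V) (S : Set V) : Set V := {v | v ∉ S ∧ ∃ u ∈ S, G.Adj u v}

/-- A walk ending outside a set `U` with clique neighbourhood can be rerouted to avoid `U`,
using only vertices of the original walk. If it starts inside `U`, the rerouted walk starts
at some vertex of the neighbourhood of `U`. -/
theorem exists_walk_avoiding_of_isClique_nbhd {G H : SimpleGraph V} {U : Set V}
    (hclique : G.IsClique (nbhd G U))
    (hH : ∀ x y, x ∉ U → y ∉ U → G.Adj x y → H.Adj x y) {a b : V} (p : G.Walk a b)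
    (hb : b ∉ U) :
    ∃ w, (w = a ∨ a ∈ U ∧ w ∈ nbhd G U) ∧
      ∃ q : H.Walk w b, ∀ x ∈ q.support, x ∈ p.support ∧ x ∉ U := by
  induction p with
  | nil => exact ⟨_, .inl rfl, .nil, by simpa using hb⟩
  | @cons u v b h p ih =>
    obtain ⟨w, hw, q, hq⟩ := ih hb
    have hwU : w ∉ U := (hq w q.start_mem_support).2
    have hq' : ∀ x ∈ q.support, x ∈ (Walk.cons h p).support ∧ x ∉ U := fun x hx =>
      ⟨List.mem_cons_of_mem _ (hq x hx).1, (hq x hx).2⟩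
    by_cases hu : u ∈ U
    · refine ⟨w, .inr ⟨hu, ?_⟩, q, hq'⟩
      rcases hw with rfl | hw
      · exact ⟨hwU, u, hu, h⟩
      · exact hw.2
    · by_cases huw : u = w
      · exact ⟨w, .inl huw.symm, q, hq'⟩
      · have hadj : G.Adj u w := by
          rcases hw with rfl | ⟨hv, hw⟩
          · exact h
          · exact hclique ⟨hu, v, hv, h.symm⟩ hw huw
        refine ⟨u, .inl rfl, .cons (hH u w hu hwU hadj) q, fun x hx => ?_⟩
        rw [Walk.support_cons, List.mem_cons] at hx
        rcases hx with rfl | hx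
        · exact ⟨Walk.start_mem_support _, hu⟩
        · exact hq' x hx

/-- Short's win depends only on the colours and the edges outside a terminal-free set with
clique neighbourhood. -/
theorem ShortWins.of_eqOn_compl {G H : SimpleGraph V} {U : Set V} {t₁ t₂ : V} {c c' : V → Bool}
    (hwin : ShortWins G t₁ t₂ c) (hU₁ : t₁ ∉ U) (hU₂ : t₂ ∉ U)
    (hclique : G.IsClique (nbhd G U))
    (hH : ∀ x y, x ∉ U → y ∉ U → G.Adj x y → H.Adj x y) (hc : ∀ x, x ∉ U → c' x = c x) :
    ShortWins H t₁ t₂ c' := by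
  obtain ⟨p, hp⟩ := hwin
  obtain ⟨w, rfl | hw, q, hq⟩ := exists_walk_avoiding_of_isClique_nbhd hclique hH p hU₂
  · refine ⟨q, fun x hx h₁ h₂ => ?_⟩
    rw [hc x (hq x hx).2]
    exact hp x (hq x hx).1 h₁ h₂
  · exact absurd hw.1 hU₁

theorem ShortWins.mono {G H : SimpleGraph V} {t₁ t₂ : V} {c : V → Bool} (h : G ≤ H)
    (hwin : ShortWins G t₁ t₂ c) : ShortWins H t₁ t₂ c := by
  obtain ⟨p, hp⟩ := hwin
  exact ⟨p.mapLe h, by simpa using hp⟩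

/-- A terminal-free vertex set `U` whose neighbourhood is a clique is dead: every
vertex of `U` is dead and every edge of `G` with an endpoint in `U` is dead. -/
theorem stmt14 [Fintype V] [DecidableEq V] (G : SimpleGraph V) (t₁ t₂ : V)
    (hne : t₁ ≠ t₂) (U : Set V) (hU₁ : t₁ ∉ U) (hU₂ : t₂ ∉ U)
    (hclique : G.IsClique (nbhd G U)) :
    (∀ v ∈ U, DeadVertex G t₁ t₂ v) ∧
    (∀ e ∈ G.edgeSet, (∃ x ∈ e, x ∈ U) → DeadEdge G t₁ t₂ e) := by
  refine ⟨fun v hv c => ?_, fun e _ ⟨u, hue, hu⟩ c =>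
    ⟨fun h => h.of_eqOn_compl hU₁ hU₂ hclique (fun x y hx hy hxy => ?_) fun _ _ => rfl,
      ShortWins.mono (deleteEdges_le _)⟩⟩
  · have hc : ∀ x, x ∉ U → Function.update c v (!c v) x = c x := fun x hx =>
      Function.update_of_ne (by rintro rfl; exact hx hv) _ _
    exact ⟨fun h => h.of_eqOn_compl hU₁ hU₂ hclique (fun _ _ _ _ => id) hc,
      fun h => h.of_eqOn_compl hU₁ hU₂ hclique (fun _ _ _ _ => id) fun x hx => (hc x hx).symm⟩
  · refine deleteEdges_adj.2 ⟨hxy, ?_⟩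
    rintro rfl
    rcases Sym2.mem_iff.1 hue with rfl | rfl
    · exact hx hu
    · exact hy hu
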